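/- Let G = (V = {1,…,n}, w) be a connected loopless weighted graph whose fractional Cheeger constant is strictly less than its Cheeger constant. Then the fractional Cheeger constant of G is attained at a fractional partition (ρ, η) satisfying Σ_u ρ(u)·vol(u) = Σ_v η(v)·vol(v) (= vol(G)/2). -/

import Mathlib

open Finset

noncomputable section

/-- A weighted graph on the vertex set `{1,…,n}` (modelled as `Fin n`):
a symmetric weight function with values in `[0,1]`. -/
structure WGraph (n : ℕ) where
  w : Fin n → Fin n → ℝ
  symm : ∀ u v, w u v = w v u
  nonneg : ∀ u v, 0 ≤ w u v
  le_one : ∀ u v, w u v ≤ 1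

namespace WGraph

variable {n : ℕ}

/-- The volume of a vertex: `vol(u) = Σ_v w(u,v)`. -/
def vol (Gr : WGraph n) (u : Fin n) : ℝ := ∑ v, Gr.w u v

/-- The total volume `vol(G) = Σ_u vol(u)`. -/
def volG (Gr : WGraph n) : ℝ := ∑ u, Gr.vol u

/-- The total weight of edges crossing the cut `(A, Aᶜ)`. -/
def cut (Gr : WGraph n) (A : Finset (Fin n)) : ℝ := ∑ u ∈ A, ∑ v ∈ Aᶜ, Gr.w u v

/-- Connectedness: every cut into two nonempty parts has positive weight. -/
def Connected (Gr : WGraph n) : Prop :=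
  ∀ A : Finset (Fin n), A.Nonempty → A ≠ Finset.univ → 0 < Gr.cut A

/-- Looplessness: `w(u,u) = 0` for all `u`. -/
def Loopless (Gr : WGraph n) : Prop := ∀ u, Gr.w u u = 0

/-- The Cheeger constant of a weighted graph. -/
def cheeger (Gr : WGraph n) : ℝ :=
  sInf {r : ℝ | ∃ A : Finset (Fin n), A.Nonempty ∧ A ≠ Finset.univ ∧
    r = Gr.cut A / min (∑ u ∈ A, Gr.vol u) (∑ v ∈ Aᶜ, Gr.vol v)}

/-- A fractional partition of the vertex set: `ρ : V → [0,1]` (with `η = 1 − ρ`). -/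
def IsFracPartition (ρ : Fin n → ℝ) : Prop := ∀ u, 0 ≤ ρ u ∧ ρ u ≤ 1

/-- The quantity `h̃(G; ρ, 1−ρ)` from the definition of the fractional Cheeger
constant. -/
def fracH (Gr : WGraph n) (ρ : Fin n → ℝ) : ℝ :=
  (∑ u, ∑ v, ρ u * (1 - ρ v) * Gr.w u v) /
    min (∑ u, ρ u * Gr.vol u) (∑ v, (1 - ρ v) * Gr.vol v)

/-- The fractional Cheeger constant: the infimum of `h̃(G; ρ, η)` over all fractional
partitions `(ρ, η = 1 − ρ)` with `Σ ρ(u)vol(u) > 0` and `Σ η(v)vol(v) > 0`. -/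
def fracCheeger (Gr : WGraph n) : ℝ :=
  sInf {r : ℝ | ∃ ρ : Fin n → ℝ, IsFracPartition ρ ∧
    0 < ∑ u, ρ u * Gr.vol u ∧ 0 < ∑ v, (1 - ρ v) * Gr.vol v ∧ r = Gr.fracH ρ}

end WGraph

namespace WGraph

variable {n : ℕ}

/-- The numerator of `fracH`: the weight crossing the fractional cut `(ρ, 1 - ρ)`. -/
def fracCut (Gr : WGraph n) (ρ : Fin n → ℝ) : ℝ := ∑ u, ∑ v, ρ u * (1 - ρ v) * Gr.w u v

/-- The volume of a fractional vertex set. -/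
def fracVol (Gr : WGraph n) (ρ : Fin n → ℝ) : ℝ := ∑ u, ρ u * Gr.vol u

lemma vol_nonneg (Gr : WGraph n) (u : Fin n) : 0 ≤ Gr.vol u :=
  Finset.sum_nonneg fun v _ => Gr.nonneg u v

lemma cut_nonneg (Gr : WGraph n) (A : Finset (Fin n)) : 0 ≤ Gr.cut A :=
  Finset.sum_nonneg fun u _ => Finset.sum_nonneg fun v _ => Gr.nonneg u v

lemma sum_one_sub_mul_vol (Gr : WGraph n) (ρ : Fin n → ℝ) :
    ∑ v, (1 - ρ v) * Gr.vol v = Gr.volG - Gr.fracVol ρ := by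
  simp only [sub_mul, one_mul, Finset.sum_sub_distrib, volG, fracVol]

lemma fracH_eq (Gr : WGraph n) (ρ : Fin n → ℝ) :
    Gr.fracH ρ = Gr.fracCut ρ / min (Gr.fracVol ρ) (Gr.volG - Gr.fracVol ρ) := by
  rw [← sum_one_sub_mul_vol]; rfl

lemma fracCut_nonneg (Gr : WGraph n) {ρ : Fin n → ℝ} (hρ : IsFracPartition ρ) :
    0 ≤ Gr.fracCut ρ :=
  Finset.sum_nonneg fun u _ => Finset.sum_nonneg fun v _ =>
    mul_nonneg (mul_nonneg (hρ u).1 (sub_nonneg.2 (hρ v).2)) (Gr.nonneg u v)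

lemma fracCut_one_sub (Gr : WGraph n) (ρ : Fin n → ℝ) :
    Gr.fracCut (fun u => 1 - ρ u) = Gr.fracCut ρ := by
  unfold fracCut
  rw [Finset.sum_comm]
  refine Finset.sum_congr rfl fun u _ => Finset.sum_congr rfl fun v _ => ?_
  rw [Gr.symm v u]; ring

lemma fracVol_add_single (Gr : WGraph n) (ρ : Fin n → ℝ) (u : Fin n) (s : ℝ) :
    Gr.fracVol (ρ + Pi.single u s) = Gr.fracVol ρ + s * Gr.vol u := by
  simp [fracVol, add_mul, Finset.sum_add_distrib, Pi.single_apply]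

/-- On a loopless graph `fracCut` is affine in each coordinate. -/
lemma Loopless.exists_fracCut_add_single {Gr : WGraph n} (hloop : Gr.Loopless)
    (ρ : Fin n → ℝ) (u : Fin n) :
    ∃ g : ℝ, ∀ s, Gr.fracCut (ρ + Pi.single u s) = Gr.fracCut ρ + s * g := by
  refine ⟨∑ v, (1 - ρ v) * Gr.w u v - ∑ v, ρ v * Gr.w v u, fun s => ?_⟩
  have expand : ∀ a b,
      (ρ + Pi.single u s : Fin n → ℝ) a * (1 - (ρ + Pi.single u s : Fin n → ℝ) b) * Gr.w a b
      = ρ a * (1 - ρ b) * Gr.w a b + (if a = u then s * ((1 - ρ b) * Gr.w a b) else 0)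
        - (if b = u then s * (ρ a * Gr.w a b) else 0) := by
    intro a b
    by_cases ha : a = u <;> by_cases hb : b = u
    · simp [ha, hb, hloop u]
    all_goals simp [ha, hb]
    all_goals ring
  simp only [fracCut, expand, Finset.sum_add_distrib, Finset.sum_sub_distrib]
  rw [Finset.sum_comm (f := fun a b => if a = u then _ else _)]
  simp only [Finset.sum_ite_eq', Finset.mem_univ, if_true, mul_sub, Finset.mul_sum]
  ring

lemma cheeger_mul_le_cut (Gr : WGraph n) {A : Finset (Fin n)} (hA : A.Nonempty)
    (hA' : A ≠ Finset.univ) :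
    Gr.cheeger * min (∑ u ∈ A, Gr.vol u) (∑ v ∈ Aᶜ, Gr.vol v) ≤ Gr.cut A := by
  have vol_min_nonneg : ∀ B : Finset (Fin n),
      0 ≤ min (∑ u ∈ B, Gr.vol u) (∑ v ∈ Bᶜ, Gr.vol v) := fun B =>
    le_min (Finset.sum_nonneg fun u _ => Gr.vol_nonneg u)
      (Finset.sum_nonneg fun u _ => Gr.vol_nonneg u)
  have hle : Gr.cheeger ≤ Gr.cut A / min (∑ u ∈ A, Gr.vol u) (∑ v ∈ Aᶜ, Gr.vol v) := by
    refine csInf_le ⟨0, ?_⟩ ⟨A, hA, hA', rfl⟩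
    rintro _ ⟨B, -, -, rfl⟩
    exact div_nonneg (Gr.cut_nonneg B) (vol_min_nonneg B)
  rcases (vol_min_nonneg A).eq_or_lt with h | h
  · rw [← h, mul_zero]; exact Gr.cut_nonneg A
  · exact (le_div_iff₀ h).1 hle

lemma cheeger_mul_le_fracCut_of_integral (Gr : WGraph n) (hvol : 0 < Gr.volG)
    {ρ : Fin n → ℝ} (hint : ∀ u, ρ u = 0 ∨ ρ u = 1) (hhalf : Gr.fracVol ρ ≤ Gr.volG / 2) :
    Gr.cheeger * Gr.fracVol ρ ≤ Gr.fracCut ρ := by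
  obtain ⟨A, rfl⟩ : ∃ A : Finset (Fin n), ρ = fun u => if u ∈ A then 1 else 0 := by
    refine ⟨Finset.univ.filter fun u => ρ u = 1, funext fun u => ?_⟩
    rcases hint u with h | h <;> simp [h]
  have hvolA : Gr.fracVol (fun u => if u ∈ A then 1 else 0) = ∑ u ∈ A, Gr.vol u := by
    simp [fracVol]
  have hcutA : Gr.fracCut (fun u => if u ∈ A then 1 else 0) = Gr.cut A := by
    have inner : ∀ u, ∑ v ∈ Aᶜ, Gr.w u v = ∑ v, (1 - if v ∈ A then (1 : ℝ) else 0) * Gr.w u v := by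
      intro u
      rw [← Finset.sum_subset (Finset.subset_univ Aᶜ)]
      · exact Finset.sum_congr rfl fun v hv => by simp [Finset.mem_compl.1 hv]
      · intro v _ hv
        simp [Finset.notMem_compl.1 hv]
    simp only [fracCut, cut, inner, mul_assoc, ← Finset.mul_sum]
    simp
  have hcompl : ∑ v ∈ Aᶜ, Gr.vol v = Gr.volG - ∑ u ∈ A, Gr.vol u :=
    eq_sub_of_add_eq (Finset.sum_compl_add_sum A Gr.vol)
  rw [hvolA] at hhalf
  rw [hvolA, hcutA]
  rcases A.eq_empty_or_nonempty with rfl | hne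
  · simpa using Gr.cut_nonneg ∅
  have hne' : A ≠ Finset.univ := by
    rintro rfl
    have : ∑ u, Gr.vol u = Gr.volG := rfl
    linarith
  have h := Gr.cheeger_mul_le_cut hne hne'
  rwa [hcompl, min_eq_left (by linarith)] at h

/-- An isoperimetric inequality with constant at most the Cheeger constant holds for all fractional
sets of at most half the volume as soon as it holds for those of exactly half the volume. -/
lemma Loopless.mul_fracVol_le_fracCut {Gr : WGraph n} (hloop : Gr.Loopless)
    (hvol : 0 < Gr.volG) {c : ℝ} (hc : c ≤ Gr.cheeger)
    (heq : ∀ ρ, IsFracPartition ρ → Gr.fracVol ρ = Gr.volG / 2 →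
      c * Gr.fracVol ρ ≤ Gr.fracCut ρ)
    (ρ : Fin n → ℝ) (hρ : IsFracPartition ρ) (hhalf : Gr.fracVol ρ ≤ Gr.volG / 2) :
    c * Gr.fracVol ρ ≤ Gr.fracCut ρ := by
  induction hk : (Finset.univ.filter fun u => ρ u ≠ 0 ∧ ρ u ≠ 1).card
    using Nat.strong_induction_on generalizing ρ with
  | _ k ih =>
  by_cases hint : ∀ u, ρ u = 0 ∨ ρ u = 1
  · have hnonneg : 0 ≤ Gr.fracVol ρ :=
      Finset.sum_nonneg fun u _ => mul_nonneg (hρ u).1 (Gr.vol_nonneg u)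
    exact (mul_le_mul_of_nonneg_right hc hnonneg).trans
      (Gr.cheeger_mul_le_fracCut_of_integral hvol hint hhalf)
  push Not at hint
  obtain ⟨u, hu⟩ := hint
  obtain ⟨g, hg⟩ := hloop.exists_fracCut_add_single ρ u
  have hpart : ∀ s, 0 ≤ ρ u + s → ρ u + s ≤ 1 → IsFracPartition (ρ + Pi.single u s) := by
    intro s h0 h1 v
    by_cases hv : v = u
    · subst hv; simpa using ⟨h0, h1⟩
    · simpa [hv] using hρ v
  -- Rounding coordinate `u` reduces the number of fractional coordinates.
  have hround : ∀ s, (ρ u + s = 0 ∨ ρ u + s = 1) → Gr.fracVol ρ + s * Gr.vol u ≤ Gr.volG / 2 →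
      c * (Gr.fracVol ρ + s * Gr.vol u) ≤ Gr.fracCut ρ + s * g := by
    intro s hs hle
    rw [← hg, ← fracVol_add_single]
    rw [← fracVol_add_single] at hle
    refine ih _ ?_ _ (hpart s ?_ ?_) hle rfl
    · rw [← hk]
      refine Finset.card_lt_card (Finset.ssubset_iff_of_subset ?_ |>.2 ⟨u, by simpa using hu, ?_⟩)
      · intro v hv
        by_cases hvu : v = u
        · subst hvu; simpa using hu
        · simpa [hvu] using hv
      · simpa [or_iff_not_imp_left] using hs
    · rcases hs with h | h <;> simp [h]
    · rcases hs with h | h <;> simp [h]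
  obtain ⟨h0, h1⟩ := hρ u
  have hv := Gr.vol_nonneg u
  rcases le_total 0 (g - c * Gr.vol u) with hsign | hsign
  · have := hround (-ρ u) (by simp) (by nlinarith)
    nlinarith
  by_cases hone : Gr.fracVol ρ + (1 - ρ u) * Gr.vol u ≤ Gr.volG / 2
  · have := hround (1 - ρ u) (by simp) hone
    nlinarith
  push Not at hone
  have hvpos : 0 < Gr.vol u := by
    rcases hv.eq_or_lt with h | h
    · rw [← h] at hone; linarith
    · exact h
  obtain ⟨s, hs⟩ : ∃ s, s = (Gr.volG / 2 - Gr.fracVol ρ) / Gr.vol u := ⟨_, rfl⟩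
  have hsv : s * Gr.vol u = Gr.volG / 2 - Gr.fracVol ρ := by
    rw [hs, div_mul_cancel₀ _ hvpos.ne']
  have hs0 : 0 ≤ s := hs ▸ div_nonneg (by linarith) hv
  have hs1 : s ≤ 1 - ρ u := hs ▸ (div_le_iff₀ hvpos).2 (by linarith)
  have := heq _ (hpart s (by linarith) (by linarith)) (by rw [fracVol_add_single]; linarith)
  rw [fracVol_add_single, hg] at this
  nlinarith

lemma exists_isMinOn_fracCut_half (Gr : WGraph n) :
    ∃ ρ, IsFracPartition ρ ∧ Gr.fracVol ρ = Gr.volG / 2 ∧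
      ∀ σ, IsFracPartition σ → Gr.fracVol σ = Gr.volG / 2 → Gr.fracCut ρ ≤ Gr.fracCut σ := by
  have hcont : Continuous Gr.fracCut := by unfold fracCut; fun_prop
  have hcontVol : Continuous Gr.fracVol := by unfold fracVol; fun_prop
  have hcompact : IsCompact (Set.Icc (0 : Fin n → ℝ) 1 ∩ Gr.fracVol ⁻¹' {Gr.volG / 2}) :=
    isCompact_Icc.inter_right (isClosed_singleton.preimage hcontVol)
  have hmem : ∀ ρ : Fin n → ℝ, ρ ∈ Set.Icc (0 : Fin n → ℝ) 1 ↔ IsFracPartition ρ := fun ρ =>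
    ⟨fun h u => ⟨h.1 u, h.2 u⟩, fun h => ⟨fun u => (h u).1, fun u => (h u).2⟩⟩
  obtain ⟨ρ, ⟨hρ, hρv⟩, hmin⟩ := hcompact.exists_isMinOn
    ⟨fun _ => 1 / 2, (hmem _).2 fun _ => by norm_num, by
      simp only [Set.mem_preimage, Set.mem_singleton_iff, fracVol, volG, ← Finset.mul_sum]
      ring⟩ hcont.continuousOn
  exact ⟨ρ, (hmem ρ).1 hρ, hρv, fun σ hσ hσv => hmin ⟨(hmem σ).2 hσ, hσv⟩⟩

lemma volG_pos_of_fracCheeger_lt (Gr : WGraph n) (hlt : Gr.fracCheeger < Gr.cheeger) :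
    0 < Gr.volG := by
  have hnonneg : 0 ≤ Gr.volG := Finset.sum_nonneg fun u _ => Gr.vol_nonneg u
  refine hnonneg.lt_of_ne' fun hzero => hlt.not_ge ?_
  have hv : ∀ u, Gr.vol u = 0 := fun u =>
    (Finset.sum_eq_zero_iff_of_nonneg fun u _ => Gr.vol_nonneg u).1 hzero u (Finset.mem_univ u)
  have hfrac : Gr.fracCheeger = 0 := by simp [fracCheeger, hv]
  rw [hfrac]
  refine Real.sInf_nonpos ?_
  rintro _ ⟨A, -, -, rfl⟩
  simp [hv]

end WGraph

/-- **Realization of the fractional Cheeger constant at an equipartition.**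
If `G` is a connected loopless weighted graph whose fractional Cheeger constant is
strictly less than its Cheeger constant, then the fractional Cheeger constant is
attained at a fractional partition `(ρ, η = 1 − ρ)` with
`Σ ρ(u)vol(u) = Σ η(v)vol(v)` (both equal to `vol(G)/2`). -/
theorem fracCheeger_attained_equipartition {n : ℕ} (Gr : WGraph n)
    (hconn : Gr.Connected) (hloop : Gr.Loopless)
    (hlt : Gr.fracCheeger < Gr.cheeger) :
    ∃ ρ : Fin n → ℝ, WGraph.IsFracPartition ρ ∧
      0 < ∑ u, ρ u * Gr.vol u ∧ 0 < ∑ v, (1 - ρ v) * Gr.vol v ∧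
      (∑ u, ρ u * Gr.vol u) = (∑ v, (1 - ρ v) * Gr.vol v) ∧
      Gr.fracH ρ = Gr.fracCheeger := by
  have hvol := Gr.volG_pos_of_fracCheeger_lt hlt
  obtain ⟨ρ, hρ, hρv, hmin⟩ := Gr.exists_isMinOn_fracCut_half
  have hH : Gr.fracH ρ = Gr.fracCut ρ / (Gr.volG / 2) := by
    rw [Gr.fracH_eq, hρv, sub_half, min_self]
  have hpos : 0 < ∑ u, ρ u * Gr.vol u := by
    change 0 < Gr.fracVol ρ
    linarith
  have hbal : ∑ u, ρ u * Gr.vol u = ∑ v, (1 - ρ v) * Gr.vol v := by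
    rw [Gr.sum_one_sub_mul_vol]
    change Gr.fracVol ρ = _
    linarith
  have hmem : Gr.fracH ρ ∈ {r : ℝ | ∃ ρ : Fin n → ℝ, WGraph.IsFracPartition ρ ∧
      0 < ∑ u, ρ u * Gr.vol u ∧ 0 < ∑ v, (1 - ρ v) * Gr.vol v ∧ r = Gr.fracH ρ} :=
    ⟨ρ, hρ, hpos, hbal ▸ hpos, rfl⟩
  refine ⟨ρ, hρ, hpos, hbal ▸ hpos, hbal, le_antisymm ?_ ?_⟩
  · by_contra! hlt'
    have hiso : ∀ σ, WGraph.IsFracPartition σ → Gr.fracVol σ ≤ Gr.volG / 2 →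
        min (Gr.fracH ρ) Gr.cheeger * Gr.fracVol σ ≤ Gr.fracCut σ := by
      refine hloop.mul_fracVol_le_fracCut hvol (min_le_right _ _) fun σ hσ hσv => ?_
      calc min (Gr.fracH ρ) Gr.cheeger * Gr.fracVol σ
          ≤ Gr.fracH ρ * Gr.fracVol σ :=
            mul_le_mul_of_nonneg_right (min_le_left _ _) (by linarith)
        _ = Gr.fracCut ρ := by rw [hH, hσv, div_mul_cancel₀ _ (by positivity)]
        _ ≤ Gr.fracCut σ := hmin σ hσ hσv
    obtain ⟨_, ⟨σ, hσ, hσ0, hσ1, rfl⟩, hσlt⟩ :=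
      exists_lt_of_csInf_lt ⟨_, hmem⟩ (lt_min hlt' hlt)
    rw [Gr.sum_one_sub_mul_vol] at hσ1
    change 0 < Gr.fracVol σ at hσ0
    rw [Gr.fracH_eq σ, div_lt_iff₀ (lt_min hσ0 hσ1)] at hσlt
    rcases le_total (Gr.fracVol σ) (Gr.volG / 2) with h | h
    · rw [min_eq_left (a := Gr.fracVol σ) (by linarith)] at hσlt
      exact hσlt.not_ge (hiso σ hσ h)
    · have hcompl : Gr.fracVol (fun u => 1 - σ u) = Gr.volG - Gr.fracVol σ :=
        Gr.sum_one_sub_mul_vol σ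
      have := hiso (fun u => 1 - σ u)
        (fun u => ⟨sub_nonneg.2 (hσ u).2, sub_le_self _ (hσ u).1⟩) (by linarith)
      rw [Gr.fracCut_one_sub, hcompl] at this
      rw [min_eq_right (a := Gr.fracVol σ) (by linarith)] at hσlt
      exact hσlt.not_ge this
  · refine csInf_le ⟨0, ?_⟩ hmem
    rintro _ ⟨σ, hσ, hσ0, hσ1, rfl⟩
    exact div_nonneg (Gr.fracCut_nonneg hσ) (lt_min hσ0 hσ1).le
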